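/- Let α ≥ −1/2 be a real number, β = −1/2, and p_1(x) = 2π²(π − x)² − (π − x)⁴ on [0, π]. Then the Jacobi coefficients of p_1 satisfy lim_{n→∞} n⁴ · b_n^{(α,−1/2)}(p_1) = 48√π Γ(α+5/2) / Γ(α+1). -/

import Mathlib

/-- The Jacobi polynomial `P_n^{(α,β)}`. -/
noncomputable def jacobiP (α β : ℝ) (n : ℕ) (x : ℝ) : ℝ :=
  Real.Gamma (α + n + 1) / (n.factorial * Real.Gamma (α + β + n + 1)) *
    ∑ k ∈ Finset.range (n + 1),
      (n.choose k : ℝ) * (Real.Gamma (α + β + n + k + 1) / Real.Gamma (α + k + 1)) *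
        ((x - 1) / 2) ^ k

/-- The Jacobi coefficient `b_n^{(α,β)}(g)` of a function `g` on `[0, π]`. -/
noncomputable def jacobiCoeff (α β : ℝ) (n : ℕ) (g : ℝ → ℝ) : ℝ :=
  (2 * n + α + β + 1) * Real.Gamma (n + α + β + 1) /
      (Real.Gamma (n + β + 1) * Real.Gamma (α + 1)) *
    ∫ x in (0:ℝ)..Real.pi, g x * jacobiP α β n (Real.cos x) *
      Real.sin (x / 2) ^ (2 * α + 1) * Real.cos (x / 2) ^ (2 * β + 1)


section Aux

open Finset

lemma trig_beta (k : ℕ) (a : ℝ) (ha : -1/2 ≤ a) :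
    ∫ x in (0:ℝ)..Real.pi, Real.cos (x/2) ^ (2*k) * Real.sin (x/2) ^ (2*a+1) =
      Real.Gamma (k + 1/2) * Real.Gamma (a+1) / Real.Gamma (k + a + 3/2) := by
  have hb := ProbabilityTheory.beta_eq_betaIntegralReal (a+1) (k+1/2) (by linarith) (by positivity)
  have h1 : (Complex.betaIntegral ((a+1 : ℝ):ℂ) ((k+1/2:ℝ):ℂ)).re =
      ∫ t in (0:ℝ)..1, t ^ a * (1-t) ^ ((k:ℝ) - 1/2) := by
    have : Complex.betaIntegral ((a+1 : ℝ):ℂ) ((k+1/2:ℝ):ℂ) =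
       ((∫ t in (0:ℝ)..1, t ^ a * (1-t) ^ ((k:ℝ) - 1/2) : ℝ) : ℂ) := by
      rw [Complex.betaIntegral, ← intervalIntegral.integral_ofReal]
      apply intervalIntegral.integral_congr
      intro t ht
      rw [Set.uIcc_of_le zero_le_one] at ht
      simp only
      rw [Complex.ofReal_mul, Complex.ofReal_cpow ht.1, Complex.ofReal_cpow (by linarith [ht.2])]
      push_cast
      congr 2 <;> ring
    rw [this, Complex.ofReal_re]
  have h2 := intervalIntegral.integral_comp_mul_deriv_of_deriv_nonneg
    (a := 0) (b := Real.pi) (f := fun x => Real.sin (x/2) ^ 2)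
    (f' := fun x => Real.sin (x/2) * Real.cos (x/2))
    (g := fun t => t ^ a * (1-t) ^ ((k:ℝ) - 1/2)) (by fun_prop)
    (by
      intro x _
      have := ((Real.hasDerivAt_sin (x/2)).comp x ((hasDerivAt_id x).div_const 2)).pow 2
      refine HasDerivAt.congr_deriv (f := fun x => Real.sin (x/2) ^ 2) this ?_
      simp; ring)
    (by
      intro x hx
      rw [min_eq_left Real.pi_pos.le, max_eq_right Real.pi_pos.le] at hx
      have := hx.1; have := hx.2
      exact mul_nonneg (Real.sin_nonneg_of_nonneg_of_le_pi (by linarith) (by linarith [Real.pi_pos]))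
        (Real.cos_nonneg_of_neg_pi_div_two_le_of_le (by linarith) (by linarith)))
  simp only [zero_div, Real.sin_zero, Real.sin_pi_div_two, one_pow] at h2
  norm_num at h2
  norm_num at h1
  rw [ProbabilityTheory.beta] at hb
  norm_num at hb
  rw [h1, ← h2] at hb
  rw [mul_comm (Real.Gamma (k+1/2)), show (k:ℝ) + a + 3/2 = a + 1 + (k + 1/2) by ring, one_div]
  norm_num
  rw [hb]
  rw [intervalIntegral.integral_of_le Real.pi_pos.le, intervalIntegral.integral_of_le Real.pi_pos.le,
    MeasureTheory.integral_Ioc_eq_integral_Ioo, MeasureTheory.integral_Ioc_eq_integral_Ioo]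
  apply MeasureTheory.setIntegral_congr_fun measurableSet_Ioo
  intro x hx
  have := hx.1; have := hx.2
  have hs : 0 < Real.sin (x/2) := Real.sin_pos_of_pos_of_lt_pi (by linarith) (by linarith [Real.pi_pos])
  have hc : 0 < Real.cos (x/2) := Real.cos_pos_of_mem_Ioo ⟨by linarith, by linarith⟩
  simp only
  rw [show 1 - Real.sin (x/2)^2 = Real.cos (x/2)^2 by rw [← Real.sin_sq_add_cos_sq (x/2)]; ring]
  rw [← Real.rpow_natCast, ← Real.rpow_natCast, ← Real.rpow_natCast, ← Real.rpow_mul hs.le, ← Real.rpow_mul hc.le]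
  rw [Real.rpow_add hs, Real.rpow_one]
  have : Real.cos (x/2) ^ (((2*k : ℕ)):ℝ) = Real.cos (x/2) ^ (((2:ℕ):ℝ) * ((k:ℝ) - 1/2)) * Real.cos (x/2) := by
    rw [← Real.rpow_add_one hc.ne']
    congr 1
    push_cast; ring
  norm_num at this ⊢
  rw [this]
  ring

lemma sum_choose_succ (n : ℕ) (f : ℕ → ℝ) :
    ∑ j ∈ range (n+2), (-1:ℝ)^j * ((n+1).choose j) * f j =
    ∑ j ∈ range (n+1), (-1:ℝ)^j * (n.choose j) * f j -
    ∑ j ∈ range (n+1), (-1:ℝ)^j * (n.choose j) * f (j+1) := by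
  have h : ∑ j ∈ range (n+1), (-1:ℝ)^j * (n.choose j) * f j =
     ∑ j ∈ range (n+2), (-1:ℝ)^j * (n.choose j) * f j := by
    rw [sum_range_succ _ (n+1)]; simp
  rw [h, sum_range_succ', sum_range_succ' _ (n+1), add_sub_right_comm, ← sum_sub_distrib]
  congr 1
  · apply sum_congr rfl
    intro j _
    rw [Nat.choose_succ_succ]; push_cast; ring
  · simp

lemma gamma_diff (n : ℕ) : ∀ p q : ℝ, 0 < p → 0 < q →
    ∑ j ∈ range (n+1), (-1:ℝ)^j * (n.choose j) * (Real.Gamma (p+j) / Real.Gamma (q+j)) =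
      (∏ i ∈ range n, (q - p + i)) * (Real.Gamma p / Real.Gamma (q + n)) := by
  induction n with
  | zero => intro p q hp hq; simp
  | succ n ih =>
    intro p q hp hq
    rw [sum_choose_succ n (fun j => Real.Gamma (p+j) / Real.Gamma (q+j)), ih p q hp hq]
    have := ih (p+1) (q+1) (by linarith) (by linarith)
    have e : ∑ j ∈ range (n+1), (-1:ℝ)^j * (n.choose j) * (Real.Gamma (p+((j+1:ℕ):ℝ)) / Real.Gamma (q+((j+1:ℕ):ℝ))) = 
      ∑ j ∈ range (n+1), (-1:ℝ)^j * (n.choose j) * (Real.Gamma (p+1+j) / Real.Gamma (q+1+j)) := by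
      apply sum_congr rfl
      intro j _
      push_cast
      rw [show p + ((j:ℝ)+1) = p+1+j by ring, show q + ((j:ℝ)+1) = q+1+j by ring]
    rw [e, this, prod_range_succ, show q + 1 - (p+1) = q - p by ring]
    push_cast
    rw [show q + 1 + (n:ℝ) = q + n + 1 by ring, show q + ((n:ℝ)+1) = q + n + 1 by ring]
    have hqn : 0 < q + n := by positivity
    rw [Real.Gamma_add_one hp.ne', Real.Gamma_add_one hqn.ne']
    have := (Real.Gamma_pos_of_pos hqn).ne'
    field_simp
    ring

/-- Saalschuetz -/
lemma saal (c s : ℝ) (hc : 0 ≤ c) (hs : 0 ≤ s) (n : ℕ) :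
    ∑ j ∈ range (n+1+1), (-1:ℝ)^j * ((n+1).choose j) *
      (Real.Gamma (c+(n+1)+j) * Real.Gamma (c+s+1/2+j) / (Real.Gamma (c+1/2+j) * Real.Gamma (c+s+1+j))) =
    Real.Gamma (c+(n+1)) * Real.Gamma (c+s+1/2) *
      (∏ i ∈ range (n+1), (1/2 + (i:ℝ))) * (∏ i ∈ range (n+1), (-s + (i:ℝ))) /
      (Real.Gamma (c+1/2+(n+1)) * Real.Gamma (c+s+1+(n+1))) := by
  induction n with
  | zero =>
    simp [sum_range_succ]
    have h1 : (0:ℝ) < c + 1/2 := by linarith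
    have h2 : (0:ℝ) < c + s + 1/2 := by linarith
    have h3 : (0:ℝ) < c + s + 1 := by linarith
    have h4 : (0:ℝ) < c + 1 := by linarith
    have g1 := (Real.Gamma_pos_of_pos h1).ne'
    have g3 := (Real.Gamma_pos_of_pos h3).ne'
    simp only [one_div] at *
    rw [Real.Gamma_add_one h1.ne', Real.Gamma_add_one h2.ne', Real.Gamma_add_one h3.ne', Real.Gamma_add_one h4.ne']
    field_simp
    ring
  | succ n ih =>
    set F : ℕ → ℝ := fun j => (-1:ℝ)^j * ((n+1).choose j) *
      (Real.Gamma (c+(n+1)+j) * Real.Gamma (c+s+1/2+j) / (Real.Gamma (c+1/2+j) * Real.Gamma (c+s+1+j))) with hF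
    set F' : ℕ → ℝ := fun j => (-1:ℝ)^j * ((n+1+1).choose j) *
      (Real.Gamma (c+((n+1:ℕ)+1)+j) * Real.Gamma (c+s+1/2+j) / (Real.Gamma (c+1/2+j) * Real.Gamma (c+s+1+j))) with hF'
    set H : ℕ → ℝ := fun j => match j with
      | 0 => 0
      | (i+1) => (c+2*(n+1)+1) * ((-1:ℝ)^i * ((n+1).choose i) *
      (Real.Gamma (c+(n+1)+i+1) * Real.Gamma (c+s+1/2+i+1) / (Real.Gamma (c+1/2+i) * Real.Gamma (c+s+1+i)))) with hH
    have key : ∀ j, (c+(n+1)+1/2)*(c+s+(n+1)+1) * F' j - (c+(n+1))*(1/2+(n+1))*(-s+(n+1)) * F j = H (j+1) - H j := by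
      intro j
      have k0 : (0:ℝ) < c + (n+1) := by positivity
      rcases j with _ | i
      · simp only [hF, hF', hH]
        simp
        have h2 : (0:ℝ) < c + s + 2⁻¹ := by positivity
        rw [show c + ((n:ℝ)+1+1) = c + (n+1) + 1 by ring, Real.Gamma_add_one k0.ne', Real.Gamma_add_one h2.ne']
        ring
      · simp only [hF, hF', hH]
        have e1 : (((n+1+1).choose (i+1) : ℕ) : ℝ) = (n+1).choose i + (n+1).choose (i+1) := by
          rw [Nat.choose_succ_succ]; push_cast; ring
        have e2 : (((n+1).choose (i+1) : ℕ) : ℝ) * (i+1) = (n+1).choose i * (n+1-i) := by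
          rcases le_or_gt i (n+1) with h | h
          · have := Nat.choose_succ_right_eq (n+1) i
            have := congrArg (Nat.cast : ℕ → ℝ) this
            push_cast [Nat.cast_sub h] at this
            exact this
          · rw [Nat.choose_eq_zero_of_lt h, Nat.choose_eq_zero_of_lt (by omega)]; simp
        rw [e1]
        set A : ℝ := ((n+1).choose i : ℝ)
        set B : ℝ := ((n+1).choose (i+1) : ℝ)
        have hB : B = A * (n+1-i) / (i+1) := by
          rw [← e2]; field_simp
        push_cast
        have p1 : (0:ℝ) < c + (n+1) + i := by positivity
        have p1' : (0:ℝ) < c + (n+1) + i + 1 := by positivity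
        have p2 : (0:ℝ) < c + s + 1/2 + i := by positivity
        have p2' : (0:ℝ) < c + s + 1/2 + i + 1 := by positivity
        have p3 : (0:ℝ) < c + 1/2 + i := by positivity
        have p4 : (0:ℝ) < c + s + 1 + i := by positivity
        have g3 := (Real.Gamma_pos_of_pos p3).ne'
        have g4 := (Real.Gamma_pos_of_pos p4).ne'
        rw [show c + ((n:ℝ)+1+1) + (i+1) = c + (n+1) + i + 1 + 1 by ring,
          show c + ((n:ℝ)+1) + (i+1) = c + (n+1) + i + 1 by ring,
          show c + s + 1/2 + ((i:ℝ)+1) = c + s + 1/2 + i + 1 by ring,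
          show c + 1/2 + ((i:ℝ)+1) = c + 1/2 + i + 1 by ring,
          show c + s + 1 + ((i:ℝ)+1) = c + s + 1 + i + 1 by ring,
          Real.Gamma_add_one p1'.ne', Real.Gamma_add_one p2'.ne', Real.Gamma_add_one p1.ne', Real.Gamma_add_one p2.ne', Real.Gamma_add_one p3.ne', Real.Gamma_add_one p4.ne']
        generalize Real.Gamma (c + (n+1) + i) = G1
        generalize Real.Gamma (c + s + 1/2 + i) = G2
        generalize Real.Gamma (c + 1/2 + i) = G3 at *
        generalize Real.Gamma (c + s + 1 + i) = G4 at *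
        rw [hB, pow_succ]
        field_simp
        ring
    have hsum := Finset.sum_range_sub H (n+1+1+1)
    rw [← sum_congr rfl (fun j _ => key j), sum_sub_distrib, ← mul_sum, ← mul_sum] at hsum
    have hF0 : ∑ j ∈ range (n+1+1+1), F j = ∑ j ∈ range (n+1+1), F j := by
      rw [sum_range_succ]; simp [hF]
    have hH0 : H (n+1+1+1) - H 0 = 0 := by simp [hH]
    rw [hF0, hH0, ih] at hsum
    have q1 : (0:ℝ) < c + 1/2 + (n+1) := by positivity
    have q2 : (0:ℝ) < c + s + 1 + (n+1) := by positivity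
    have q3 : (0:ℝ) < c + (n+1) := by positivity
    have g1 := (Real.Gamma_pos_of_pos q1).ne'
    have g2 := (Real.Gamma_pos_of_pos q2).ne'
    have q1' : c + 1/2 + ((n:ℝ)+1) = c + (n+1) + 1/2 := by ring
    have q2' : c + s + 1 + ((n:ℝ)+1) = c + s + (n+1) + 1 := by ring
    rw [prod_range_succ _ (n+1), prod_range_succ _ (n+1)]
    push_cast
    rw [show c + 1/2 + ((n:ℝ)+1+1) = c + 1/2 + (n+1) + 1 by ring,
      show c + s + 1 + ((n:ℝ)+1+1) = c + s + 1 + (n+1) + 1 by ring,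
      show c + ((n:ℝ)+1+1) = c + (n+1) + 1 by ring, Real.Gamma_add_one q1.ne', Real.Gamma_add_one q2.ne', Real.Gamma_add_one q3.ne']
    rw [eq_div_iff (by positivity)]
    have := sub_eq_zero.mp hsum
    rw [← q1', ← q2'] at this
    generalize (range (n+1+1+1)).sum F' = S at *
    generalize ∏ i ∈ range (n+1), (1/2 + (i:ℝ)) = P1 at *
    generalize ∏ i ∈ range (n+1), (-s + (i:ℝ)) = P2 at *
    have t : S * ((c + 1/2 + (n+1)) * Real.Gamma (c + 1/2 + (n+1)) * ((c + s + 1 + (n+1)) * Real.Gamma (c + s + 1 + (n+1)))) = 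
      ((c + 1/2 + (n+1)) * (c + s + 1 + (n+1)) * S) * (Real.Gamma (c + 1/2 + (n+1)) * Real.Gamma (c + s + 1 + (n+1))) := by ring
    rw [t, this]
    field_simp

lemma mom_formula (α : ℝ) (hα : -1/2 ≤ α) (s : ℝ) (hs : 0 ≤ s) (k n : ℕ) :
    ∫ x in (0:ℝ)..Real.pi, (Real.cos (x/2) ^ (2*k) * Real.sin (x/2) ^ (2*s)) *
      jacobiP α (-1/2) n (Real.cos x) *
      Real.sin (x / 2) ^ (2 * α + 1) * Real.cos (x / 2) ^ (2 * (-1/2:ℝ) + 1) =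
    Real.Gamma (α + n + 1) / (n.factorial * Real.Gamma (α + (-1/2) + n + 1)) *
      ∑ j ∈ range (n+1), (-1:ℝ)^j * (n.choose j) *
        ((Real.Gamma (α + (-1/2) + n + j + 1) / Real.Gamma (α + j + 1)) *
         (Real.Gamma (k + 1/2) * Real.Gamma (j + α + s + 1) / Real.Gamma (k + (j + α + s) + 3/2))) := by
  have h : ∀ j : ℕ, Real.Gamma (k + 1/2) * Real.Gamma (j + α + s + 1) / Real.Gamma (k + (j + α + s) + 3/2) =
      ∫ x in (0:ℝ)..Real.pi, Real.cos (x/2) ^ (2*k) * Real.sin (x/2) ^ (2*(j + α + s)+1) := by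
    intro j
    rw [trig_beta k (j + α + s) (by have : (0:ℝ) ≤ j := by positivity
                                    linarith)]
  simp_rw [h]
  rw [mul_sum]
  simp_rw [← intervalIntegral.integral_const_mul]
  rw [← intervalIntegral.integral_finsetSum]
  · apply intervalIntegral.integral_congr
    intro x hx
    rw [Set.uIcc_of_le Real.pi_pos.le] at hx
    have hx1 := hx.1; have hx2 := hx.2
    have hsin : 0 ≤ Real.sin (x/2) := Real.sin_nonneg_of_nonneg_of_le_pi (by linarith) (by linarith [Real.pi_pos])
    simp only [jacobiP]
    rw [show (2 * (-1/2:ℝ) + 1) = 0 by norm_num, Real.rpow_zero, mul_one, mul_sum, mul_sum, sum_mul]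
    apply sum_congr rfl
    intro j _
    have hc : (Real.cos x - 1)/2 = - (Real.sin (x/2))^2 := by
      have : Real.cos x = Real.cos (2 * (x/2)) := by congr 1; ring
      rw [this, Real.cos_two_mul, Real.cos_sq']; ring
    have e : Real.sin (x/2) ^ (2*(j + α + s)+1) = (Real.sin (x/2) ^ 2)^j * Real.sin (x/2) ^ (2*α+1) * Real.sin (x/2) ^ (2*s) := by
      rw [show 2*(j + α + s)+1 = ((2*j:ℕ):ℝ) + (2*α+1) + 2*s by push_cast; ring,
        Real.rpow_add_of_nonneg hsin (by have : (0:ℝ) ≤ ((2*j:ℕ):ℝ) := by positivity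
                                         linarith) (by linarith), 
        Real.rpow_add_of_nonneg hsin (by positivity) (by linarith), Real.rpow_natCast, pow_mul]
    rw [hc, e, neg_pow]
    ring
  · intro j _
    apply Continuous.intervalIntegrable
    have : Continuous fun x : ℝ => Real.sin (x/2) ^ (2*(j + α + s)+1) := by
      apply Continuous.rpow_const (by fun_prop)
      intro x; right
      have : (0:ℝ) ≤ j := by positivity
      linarith
    fun_prop

lemma prod_desc (n k : ℕ) : ∏ i ∈ range n, ((k:ℝ) + 1 - n + i) = (k.descFactorial n : ℝ) := by
  rcases lt_or_ge k n with h | h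
  · rw [Nat.descFactorial_of_lt h]
    rw [prod_eq_zero (i := n - 1 - k) (by simp; omega)]
    · simp
    · rw [Nat.cast_sub (by omega), Nat.cast_sub (by omega)]; push_cast; ring
  · rw [Nat.descFactorial_eq_prod_range, ← prod_range_reflect, Nat.cast_prod]
    apply prod_congr rfl
    intro i hi
    have := mem_range.mp hi
    rw [Nat.cast_sub (by omega), Nat.cast_sub (by omega), Nat.cast_sub (by omega)]; push_cast; ring

lemma mom_pow (α : ℝ) (hα : -1/2 ≤ α) (k n : ℕ) (hn : 1 ≤ n) :
    ∫ x in (0:ℝ)..Real.pi, (Real.cos (x/2) ^ (2*k)) *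
      jacobiP α (-1/2) n (Real.cos x) *
      Real.sin (x / 2) ^ (2 * α + 1) * Real.cos (x / 2) ^ (2 * (-1/2:ℝ) + 1) =
    Real.Gamma (α + n + 1) / n.factorial * Real.Gamma (k + 1/2) * k.descFactorial n / 
      Real.Gamma (α + 3/2 + k + n) := by
  have h := mom_formula α hα 0 le_rfl k n
  simp only [mul_zero, Real.rpow_zero, mul_one, add_zero] at h
  rw [h]
  have hn' : (1:ℝ) ≤ n := by exact_mod_cast hn
  have g := gamma_diff n (α + 1/2 + n) (k + α + 3/2) (by linarith) (by linarith [(Nat.cast_nonneg k : (0:ℝ) ≤ k)])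
  rw [show ∏ i ∈ range n, (((k:ℝ) + α + 3/2) - (α + 1/2 + n) + i) = ∏ i ∈ range n, ((k:ℝ) + 1 - n + i) from
    prod_congr rfl (fun i _ => by ring), prod_desc] at g
  have e : ∑ j ∈ range (n+1), (-1:ℝ)^j * (n.choose j) *
        ((Real.Gamma (α + (-1/2) + n + j + 1) / Real.Gamma (α + j + 1)) *
         (Real.Gamma (k + 1/2) * Real.Gamma (j + α + 1) / Real.Gamma (k + (j + α) + 3/2))) =
      Real.Gamma (k+1/2) * ∑ j ∈ range (n+1), (-1:ℝ)^j * (n.choose j) * (Real.Gamma (α + 1/2 + n + j) / Real.Gamma (k + α + 3/2+j)) := by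
    rw [mul_sum]
    apply sum_congr rfl
    intro j _
    have hj : 0 < α + j + 1 := by linarith [(Nat.cast_nonneg j : (0:ℝ) ≤ j)]
    have := (Real.Gamma_pos_of_pos hj).ne'
    rw [show α + (-1/2) + (n:ℝ) + j + 1 = α + 1/2 + n + j by ring, show (j:ℝ) + α + 1 = α + j + 1 by ring,
      show (k:ℝ) + (j + α) + 3/2 = k + α + 3/2 + j by ring]
    field_simp
  rw [e, g, show α + (-1/2) + (n:ℝ) + 1 = α + 1/2 + n by ring, show (k:ℝ) + α + 3/2 + n = α + 3/2 + k + n by ring]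
  have := (Real.Gamma_pos_of_pos (show 0 < α + 1/2 + n by linarith)).ne'
  generalize Real.Gamma (α + 1/2 + n) = G1 at *
  generalize Real.Gamma (α + 3/2 + k + n) = G2 at *
  field_simp

lemma mom_sin (α : ℝ) (hα : -1/2 ≤ α) (n : ℕ) (hn : 1 ≤ n) :
    ∫ x in (0:ℝ)..Real.pi, (Real.sin (x/2) ^ (3:ℝ)) *
      jacobiP α (-1/2) n (Real.cos x) *
      Real.sin (x / 2) ^ (2 * α + 1) * Real.cos (x / 2) ^ (2 * (-1/2:ℝ) + 1) =
    √Real.pi * Real.Gamma (α + 5/2) * (∏ i ∈ range n, (1/2 + (i:ℝ))) * (∏ i ∈ range n, (-(3/2) + (i:ℝ))) /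
      (n.factorial * Real.Gamma (α + 3 + n)) := by
  have h := mom_formula α hα (3/2) (by norm_num) 0 n
  rw [show (2*(3/2):ℝ) = 3 by norm_num] at h
  simp only [mul_zero, pow_zero, one_mul, Nat.cast_zero, zero_add] at h
  rw [h, Real.Gamma_one_half_eq]
  have hn' : (1:ℝ) ≤ n := by exact_mod_cast hn
  obtain ⟨m, rfl⟩ : ∃ m, n = m + 1 := ⟨n-1, by omega⟩
  have S := saal (α+1/2) (3/2) (by linarith) (by norm_num) m
  have e : ∑ j ∈ range (m+1+1), (-1:ℝ)^j * ((m+1).choose j) *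
        ((Real.Gamma (α + (-1/2) + (m+1:ℕ) + j + 1) / Real.Gamma (α + j + 1)) *
         (√Real.pi * Real.Gamma (j + α + 3/2 + 1) / Real.Gamma ((j + α + 3/2) + 3/2))) =
      √Real.pi * ∑ j ∈ range (m+1+1), (-1:ℝ)^j * ((m+1).choose j) *
      (Real.Gamma (α+1/2+(m+1)+j) * Real.Gamma (α+1/2+3/2+1/2+j) / (Real.Gamma (α+1/2+1/2+j) * Real.Gamma (α+1/2+3/2+1+j))) := by
    rw [mul_sum]
    apply sum_congr rfl
    intro j _
    push_cast
    rw [show α + (-1/2) + ((m:ℝ)+1) + j + 1 = α+1/2+(m+1)+j by ring, show (j:ℝ) + α + 3/2 + 1 = α+1/2+3/2+1/2+j by ring,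
      show ((j:ℝ) + α + 3/2) + 3/2 = α+1/2+3/2+1+j by ring, show α + (j:ℝ) + 1 = α+1/2+1/2+j by ring]
    field_simp
  rw [e, S]
  push_cast at hn' ⊢
  rw [show α + ((m:ℝ)+1) + 1 = α + 1/2+1/2+(m+1) by ring, show α + (-1/2) + ((m:ℝ)+1) + 1 = α + 1/2 + (m+1) by ring,
    show α + 1/2+3/2+1+((m:ℝ)+1) = α + 3 + (m+1) by ring, show α + 1/2 + 3/2 + 1/2 = α + 5/2 by ring]
  have := (Real.Gamma_pos_of_pos (show 0 < α + 1/2 + (m+1) by linarith)).ne'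
  have := (Real.Gamma_pos_of_pos (show 0 < α + 1/2 + 1/2 + (m+1) by linarith)).ne'
  generalize Real.Gamma (α + 1/2 + (m+1)) = G1 at *
  generalize Real.Gamma (α + 1/2 + 1/2 + (m+1)) = G2 at *
  generalize ∏ i ∈ range (m+1), (1/2 + (i:ℝ)) = P1 at *
  generalize ∏ i ∈ range (m+1), (-(3/2) + (i:ℝ)) = P2 at *
  field_simp

noncomputable def poch (s : ℝ) (n : ℕ) : ℝ := ∏ i ∈ range n, (s + (i:ℝ))

lemma poch_succ (s : ℝ) (n : ℕ) : poch s (n+1) = poch s n * (s + n) := prod_range_succ _ _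

lemma poch_pos (s : ℝ) (hs : 0 < s) (n : ℕ) : 0 < poch s n :=
  prod_pos (fun i _ => by positivity)

lemma gamma_poch (s : ℝ) (hs : 0 < s) (n : ℕ) : Real.Gamma (s + n) = Real.Gamma s * poch s n := by
  induction n with
  | zero => simp [poch]
  | succ n ih =>
    have : 0 < s + n := by positivity
    rw [poch_succ, Nat.cast_succ, ← add_assoc, Real.Gamma_add_one this.ne', ih]; ring

/-- half angle square -/
noncomputable def vv (y : ℝ) : ℝ := (1 - Real.cos y) / 2

lemma vv_deriv (y : ℝ) : HasDerivAt vv (Real.sin y / 2) y := by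
  have := ((Real.hasDerivAt_cos y).const_sub 1).div_const 2
  exact HasDerivAt.congr_deriv (f := vv) this (by simp)

lemma vv_eq (y : ℝ) : vv y = Real.sin (y/2)^2 := by
  have : Real.cos y = Real.cos (2 * (y/2)) := by congr 1; ring
  rw [vv, this, Real.cos_two_mul, Real.cos_sq']; ring

lemma vv_nonneg (y : ℝ) : 0 ≤ vv y := by rw [vv_eq]; positivity

lemma vv_pow_d1 (k : ℕ) (y : ℝ) : HasDerivAt (fun y => vv y ^ (k+1)) ((k+1) * vv y ^ k * (Real.sin y / 2)) y := by
  have := (vv_deriv y).fun_pow (k+1)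
  simpa using this

lemma vv_pow_d2 (k : ℕ) (y : ℝ) : HasDerivAt (fun y => (k+1) * vv y ^ k * (Real.sin y / 2))
    ((k+1)*((k+1/2) * vv y ^ k - (k+1) * vv y ^ (k+1))) y := by
  have h1 := (((vv_deriv y).fun_pow k).const_mul ((k:ℝ)+1)).mul ((Real.hasDerivAt_sin y).div_const 2)
  refine HasDerivAt.congr_deriv h1 ?_
  have hs : Real.sin y ^ 2 = 4 * vv y * (1 - vv y) := by
    rw [Real.sin_sq, vv]; ring
  have hc : Real.cos y = 1 - 2 * vv y := by rw [vv]; ring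
  rw [hc]
  rcases k with _ | k
  · simp; ring
  · simp only [Nat.add_sub_cancel]
    have : ((k+1:ℕ):ℝ) * vv y ^ k * (Real.sin y / 2) * (Real.sin y / 2) = (k+1:ℕ) * vv y ^ k * (vv y * (1 - vv y)) := by
      have : ((k+1:ℕ):ℝ) * vv y ^ k * (Real.sin y / 2) * (Real.sin y / 2) = ((k+1:ℕ):ℝ) * vv y ^ k * (Real.sin y ^2 / 4) := by ring
      rw [this, hs]; ring
    rw [mul_assoc ((((k+1:ℕ)):ℝ)+1), this]
    push_cast
    ring

lemma telesc (d e : ℕ → ℝ) (hd : ∀ k : ℕ, (k+1:ℝ)*(k+1/2) * d (k+1) = k^2 * d k + e k) (N : ℕ) (v : ℝ) :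
    ∑ k ∈ range N, d (k+1) * ((k+1)*((k+1/2) * v ^ k - (k+1) * v ^ (k+1))) =
      ∑ k ∈ range N, e k * v^k - N^2 * d N * v^N := by
  induction N with
  | zero => simp
  | succ N ih =>
    rw [sum_range_succ, ih, sum_range_succ]
    have := hd N
    push_cast
    have e1 : d (N+1) * ((N+1)*((N+1/2) * v ^ N - (N+1) * v ^ (N+1))) =
       ((N+1:ℝ)*(N+1/2) * d (N+1)) * v^N - (N+1)^2 * d (N+1) * v^(N+1) := by ring
    rw [e1, this]; ring

lemma two_step (f f' f'' : ℝ → ℝ) (h1 : ∀ y, HasDerivAt f (f' y) y) (h2 : ∀ y, HasDerivAt f' (f'' y) y)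
    (h0 : f 0 = 0) (h0' : f' 0 = 0) (Y ε : ℝ) (hε : 0 ≤ ε) (hb : ∀ y ∈ Set.Icc 0 Y, |f'' y| ≤ ε) :
    ∀ y ∈ Set.Icc 0 Y, |f y| ≤ ε * Y^2 := by
  intro y hy
  have hY : 0 ≤ Y := hy.1.trans hy.2
  have a1 : ∀ z ∈ Set.Icc 0 Y, |f' z| ≤ ε * Y := by
    intro z hz
    have := norm_image_sub_le_of_norm_deriv_le_segment' (f := f') (f' := f'') (a := 0) (b := Y) (C := ε)
      (fun x _ => (h2 x).hasDerivWithinAt) (fun x hx => hb x ⟨hx.1, hx.2.le⟩) z hz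
    rw [h0', sub_zero, sub_zero, Real.norm_eq_abs] at this
    exact this.trans (mul_le_mul_of_nonneg_left hz.2 hε)
  have := norm_image_sub_le_of_norm_deriv_le_segment' (f := f) (f' := f') (a := 0) (b := Y) (C := ε * Y)
      (fun x _ => (h1 x).hasDerivWithinAt) (fun x hx => a1 x ⟨hx.1, hx.2.le⟩) y hy
  rw [h0, sub_zero, sub_zero, Real.norm_eq_abs] at this
  refine this.trans ?_
  have := mul_le_mul_of_nonneg_left hy.2 (mul_nonneg hε hY)
  linarith [this, sq Y, mul_assoc ε Y Y, show ε * Y^2 = ε * Y * Y by ring]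

lemma series_bound (d e : ℕ → ℝ) (hd : ∀ k : ℕ, (k+1:ℝ)*(k+1/2) * d (k+1) = k^2 * d k + e k)
    (g g' h : ℝ → ℝ) (h1 : ∀ y, HasDerivAt g (g' y) y) (h2 : ∀ y, HasDerivAt g' (h y) y)
    (h0 : g 0 = 0) (h0' : g' 0 = 0) (Y δ : ℝ) (hY : Y ≤ Real.pi) (hδ : 0 ≤ δ) (N : ℕ)
    (hb : ∀ y ∈ Set.Icc 0 Y, |h y - ∑ k ∈ range N, e k * vv y ^k| ≤ δ) :
    ∀ y ∈ Set.Icc 0 Y, |g y - ∑ k ∈ range N, d (k+1) * vv y ^ (k+1)| ≤ (δ + N^2 * |d N| * vv Y ^ N) * Y^2 := by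
  apply two_step (fun y => g y - ∑ k ∈ range N, d (k+1) * vv y ^ (k+1))
    (fun y => g' y - ∑ k ∈ range N, d (k+1) * ((k+1) * vv y ^ k * (Real.sin y / 2)))
    (fun y => h y - ∑ k ∈ range N, d (k+1) * ((k+1)*((k+1/2) * vv y ^ k - (k+1) * vv y ^ (k+1))))
  · intro y
    exact (h1 y).sub (HasDerivAt.fun_sum (fun k _ => (vv_pow_d1 k y).const_mul _))
  · intro y
    exact (h2 y).sub (HasDerivAt.fun_sum (fun k _ => (vv_pow_d2 k y).const_mul _))
  · simp [h0, vv]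
  · simp [h0']
  · have := vv_nonneg Y
    positivity
  · intro y hy
    rw [telesc d e hd N (vv y)]
    have e1 : h y - (∑ k ∈ range N, e k * vv y ^ k - N^2 * d N * vv y ^ N) = 
      (h y - ∑ k ∈ range N, e k * vv y ^ k) + N^2 * d N * vv y ^ N := by ring
    rw [e1]
    refine (abs_add_le _ _).trans (add_le_add (hb y hy) ?_)
    rw [abs_mul, abs_mul, abs_of_nonneg (pow_nonneg (vv_nonneg y) N), abs_of_nonneg (by positivity : (0:ℝ) ≤ (N:ℝ)^2)]
    apply mul_le_mul_of_nonneg_left _ (by positivity)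
    apply pow_le_pow_left₀ (vv_nonneg y)
    unfold vv
    have := Real.cos_le_cos_of_nonneg_of_le_pi hy.1 hY hy.2
    linarith

noncomputable def qq (k : ℕ) : ℝ := 2 * k.factorial / (k^2 * poch (1/2) k)
noncomputable def tt (k : ℕ) : ℝ := Real.pi^2/6 - ∑ j ∈ range k, 1/(j:ℝ)^2
noncomputable def aa (k : ℕ) : ℝ := 12 * qq k * tt k

lemma qq_rec (k : ℕ) : (k+1:ℝ)*(k+1/2) * qq (k+1) = k^2 * qq k + (if k = 0 then 2 else 0) := by
  rcases k with _ | k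
  · norm_num [qq, poch]
  · have := (poch_pos (1/2) (by norm_num) (k+1)).ne'
    simp only [qq, poch_succ _ (k+1), Nat.factorial_succ (k+1)]
    rw [if_neg (by omega), add_zero]
    push_cast
    have : (1/2 + ((k:ℝ)+1)) ≠ 0 := by positivity
    have : ((k:ℝ)+1+1/2) ≠ 0 := by positivity
    generalize poch (1/2) (k+1) = P at *
    field_simp
    ring

lemma qq_nonneg (k : ℕ) : 0 ≤ qq k := by
  have := poch_pos (1/2) (by norm_num) k
  unfold qq; positivity

lemma qq_zero : qq 0 = 0 := by simp [qq]

lemma qq_le (k : ℕ) : qq k ≤ 4 := by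
  induction k with
  | zero => rw [qq_zero]; norm_num
  | succ k ih =>
    have h := qq_rec k
    rcases k with _ | k
    · norm_num at h; linarith
    · rw [if_neg (by omega), add_zero] at h
      have h0 := qq_nonneg (k+1)
      push_cast at h
      have p : (0:ℝ) < ((k:ℝ)+1+1)*((k:ℝ)+1+1/2) := by positivity
      by_contra hc
      push Not at hc
      have k0 : (0:ℝ) ≤ k := Nat.cast_nonneg k
      nlinarith [mul_lt_mul_of_pos_left hc p, mul_le_mul_of_nonneg_left ih (sq_nonneg ((k:ℝ)+1))]

lemma tt_succ (k : ℕ) : tt (k+1) = tt k - 1/(k:ℝ)^2 := by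
  rw [tt, tt, sum_range_succ]; ring

lemma tt_nonneg (k : ℕ) : 0 ≤ tt k := by
  have := sum_le_hasSum (range k) (fun i _ => by positivity) hasSum_zeta_two
  unfold tt; linarith

lemma tt_le (k : ℕ) : tt k ≤ Real.pi^2/6 := by
  have : 0 ≤ ∑ j ∈ range k, 1/(j:ℝ)^2 := sum_nonneg (fun i _ => by positivity)
  unfold tt; linarith

lemma aa_rec (k : ℕ) : (k+1:ℝ)*(k+1/2) * aa (k+1) = k^2 * aa k + (if k = 0 then 4*Real.pi^2 else -12 * qq k) := by
  have h := qq_rec k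
  unfold aa
  have : (k+1:ℝ)*(k+1/2) * (12 * qq (k+1) * tt (k+1)) = 12 * tt (k+1) * ((k+1:ℝ)*(k+1/2) * qq (k+1)) := by ring
  rw [this, h, tt_succ]
  rcases k with _ | k
  · simp [tt]; ring
  · rw [if_neg (by omega), if_neg (by omega)]
    push_cast
    field_simp
    ring

lemma aa_nonneg (k : ℕ) : 0 ≤ aa k := by
  have := qq_nonneg k; have := tt_nonneg k
  unfold aa; positivity

lemma aa_le (k : ℕ) : aa k ≤ 8 * Real.pi^2 := by
  have h1 := qq_le k; have h2 := tt_le k; have := tt_nonneg k; have := qq_nonneg k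
  have := mul_le_mul h1 h2 (tt_nonneg k) (by norm_num)
  unfold aa; linarith

lemma q_series (Y : ℝ) (hY : Y ≤ Real.pi) (N : ℕ) (hN : 1 ≤ N) :
    ∀ y ∈ Set.Icc 0 Y, |y^2 - ∑ k ∈ range N, qq (k+1) * vv y ^ (k+1)| ≤ (N^2 * 4 * vv Y ^ N) * Y^2 := by
  intro y hy
  have := series_bound qq (fun k => if k = 0 then 2 else 0) qq_rec (fun y => y^2) (fun y => 2*y) (fun _ => 2)
    (fun y => by simpa using (hasDerivAt_pow 2 y)) (fun y => by simpa using (hasDerivAt_id y).const_mul 2) (by simp) (by simp)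
    Y 0 hY le_rfl N (by
      intro y _
      obtain ⟨m, rfl⟩ : ∃ m, N = m + 1 := ⟨N-1, by omega⟩
      rw [sum_range_succ']; simp) y hy
  refine this.trans ?_
  rw [zero_add, abs_of_nonneg (qq_nonneg N)]
  have := vv_nonneg Y
  have := qq_le N
  gcongr

lemma a_series (Y : ℝ) (hY : Y ≤ Real.pi) (N : ℕ) (hN : 1 ≤ N) :
    ∀ y ∈ Set.Icc 0 Y, |(2*Real.pi^2*y^2 - y^4) - ∑ k ∈ range (N+1), aa (k+1) * vv y ^ (k+1)| ≤
       (12 * ((N^2 * 4 * vv Y ^ N) * Y^2) + (N+1:ℕ)^2 * (8*Real.pi^2) * vv Y ^ (N+1)) * Y^2 := by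
  intro y hy
  have hvY := vv_nonneg Y
  have := series_bound aa (fun k => if k = 0 then 4*Real.pi^2 else -12 * qq k) aa_rec
    (fun y => 2*Real.pi^2*y^2 - y^4) (fun y => 2*Real.pi^2*(2*y) - 4*y^3) (fun y => 2*Real.pi^2*2 - 4*(3*y^2))
    (fun y => by simpa using ((hasDerivAt_pow 2 y).const_mul (2*Real.pi^2)).fun_sub (hasDerivAt_pow 4 y))
    (fun y => by simpa using (((hasDerivAt_id y).const_mul 2).const_mul (2*Real.pi^2)).fun_sub ((hasDerivAt_pow 3 y).const_mul 4)) (by simp) (by simp)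
    Y (12 * ((N^2 * 4 * vv Y ^ N) * Y^2)) hY (by positivity) (N+1) (by
      intro y hy
      rw [sum_range_succ']
      have := q_series Y hY N hN y hy
      simp only [Nat.succ_ne_zero, if_false, if_true, pow_zero, mul_one]
      have e : 2*Real.pi^2*2 - 4*(3*y^2) - (∑ k ∈ range N, -12 * qq (k+1) * vv y ^ (k+1) + 4*Real.pi^2) = 
        -12 * (y^2 - ∑ k ∈ range N, qq (k+1) * vv y ^ (k+1)) := by
        rw [mul_sub, mul_sum]
        simp_rw [← mul_assoc]
        ring
      rw [e, abs_mul]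
      norm_num
      exact this) y hy
  refine this.trans ?_
  rw [abs_of_nonneg (aa_nonneg (N+1))]
  have := aa_le (N+1)
  gcongr

lemma aa_hasSum (y : ℝ) (hy0 : 0 ≤ y) (hy : y < Real.pi) :
    HasSum (fun k => aa k * vv y ^ k) (2*Real.pi^2*y^2 - y^4) := by
  have hv := vv_nonneg y
  have hv1 : vv y < 1 := by
    unfold vv
    have := Real.cos_lt_cos_of_nonneg_of_le_pi hy0 le_rfl hy
    rw [Real.cos_pi] at this
    linarith
  rw [hasSum_iff_tendsto_nat_of_nonneg (fun k => mul_nonneg (aa_nonneg k) (pow_nonneg hv k))]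
  have hp : Filter.Tendsto (fun N : ℕ => (N:ℝ)^2 * vv y ^ N) Filter.atTop (nhds 0) :=
    tendsto_pow_const_mul_const_pow_of_abs_lt_one 2 (by rw [abs_of_nonneg hv]; exact hv1)
  rw [← Filter.tendsto_add_atTop_iff_nat 2]
  rw [tendsto_iff_dist_tendsto_zero]
  have hlim : Filter.Tendsto (fun N : ℕ => (12 * (((N:ℝ)^2 * vv y ^ N) * 4 * y^2) + ((N+1:ℕ):ℝ)^2 * vv y ^ (N+1) * (8*Real.pi^2)) * y^2) Filter.atTop (nhds 0) := by
    have := ((((hp.mul_const 4).mul_const (y^2)).const_mul 12).add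
      (((Filter.tendsto_add_atTop_iff_nat (f := fun N : ℕ => (N:ℝ)^2 * vv y ^ N) 1).mpr hp).mul_const (8*Real.pi^2))).mul_const (y^2)
    simpa using this
  refine squeeze_zero' (Filter.Eventually.of_forall fun _ => dist_nonneg) ?_ hlim
  filter_upwards [Filter.eventually_ge_atTop 1] with N hN
  have := a_series y hy.le N hN y ⟨hy0, le_rfl⟩
  rw [dist_comm, Real.dist_eq, show N + 2 = (N+1)+1 from rfl, sum_range_succ']
  have z : aa 0 * vv y ^ 0 = 0 := by simp [aa, qq_zero]
  rw [z, add_zero]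
  refine this.trans (le_of_eq ?_)
  ring

noncomputable def eb (k : ℕ) : ℝ := poch (-(3/2)) k / k.factorial

lemma eb_hasSum (u : ℝ) (hu0 : 0 ≤ u) (hu : u < 1) :
    HasSum (fun k => eb k * u ^ k) ((1-u)^(3/2:ℝ)) := by
  have h := (Real.one_div_one_sub_rpow_hasFPowerSeriesOnBall_zero (-(3/2))).hasSum (y := u)
    (by simp [enorm_eq_nnnorm]; rw [← NNReal.coe_lt_coe]; simpa [abs_of_nonneg hu0] using hu)
  have hc : ∀ n : ℕ, Ring.choose (-(3/2:ℝ) + n - 1) n = eb n := by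
    intro n
    rw [← Ring.multichoose_eq]
    have := Ring.factorial_nsmul_multichoose_eq_ascPochhammer (-(3/2:ℝ)) n
    rw [Polynomial.ascPochhammer_smeval_eq_eval] at this
    have hp : ∀ m : ℕ, (ascPochhammer ℝ m).eval (-(3/2:ℝ)) = poch (-(3/2)) m := by
      intro m
      induction m with
      | zero => simp [poch]
      | succ m ih => rw [ascPochhammer_succ_eval, ih, poch_succ]
    rw [hp, nsmul_eq_mul] at this
    rw [eb, ← this]
    have : (n.factorial : ℝ) ≠ 0 := by positivity
    field_simp
  simp only [zero_add, FormalMultilinearSeries.ofScalars_apply_eq, hc, smul_eq_mul] at h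
  rw [one_div, ← Real.rpow_neg (by linarith), neg_neg] at h
  exact h

lemma poch_asymp (s : ℝ) (hs : Real.Gamma s ≠ 0) :
    Filter.Tendsto (fun n : ℕ => poch s n / n.factorial * (n:ℝ)^(1-s)) Filter.atTop (nhds (1 / Real.Gamma s)) := by
  have h1 := Real.GammaSeq_tendsto_Gamma s
  have h2 : Filter.Tendsto (fun n : ℕ => (n:ℝ) / (n + s)) Filter.atTop (nhds 1) :=
    tendsto_natCast_div_add_atTop s
  have h3 := h2.div h1 hs
  refine h3.congr' ?_
  filter_upwards [Filter.eventually_gt_atTop 0, h1.eventually_ne hs] with n hn hne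
  have hn' : (0:ℝ) < n := by exact_mod_cast hn
  simp only [Pi.div_apply]
  have e : Real.GammaSeq s n = (n:ℝ)^s * n.factorial / (poch s n * (s + n)) := by
    rw [Real.GammaSeq, ← poch_succ, poch]
  rw [e] at hne ⊢
  have hd : poch s n * (s + n) ≠ 0 := by
    intro h; rw [h] at hne; simp at hne
  have hp := left_ne_zero_of_mul hd
  have hsn := right_ne_zero_of_mul hd
  have hsn' : (n:ℝ) + s ≠ 0 := by rwa [add_comm]
  rw [Real.rpow_sub hn', Real.rpow_one]
  have : (n:ℝ)^s ≠ 0 := (Real.rpow_pos_of_pos hn' s).ne'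
  have : (n.factorial:ℝ) ≠ 0 := by positivity
  rw [add_comm s]
  field_simp

lemma tt_tendsto : Filter.Tendsto tt Filter.atTop (nhds 0) := by
  have := hasSum_zeta_two.tendsto_sum_nat.const_sub (Real.pi^2/6)
  rw [sub_self] at this
  exact this

lemma tt_lower (k : ℕ) : 1/((k:ℝ)+1) ≤ tt (k+1) := by
  have ha : Antitone (fun k : ℕ => tt (k+1) - 1/((k:ℝ)+1)) := by
    apply antitone_nat_of_succ_le
    intro n
    rw [tt_succ (n+1)]
    push_cast
    have : 1/((n:ℝ)+1) - 1/((n:ℝ)+1+1) ≤ 1/((n:ℝ)+1)^2 := by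
      rw [div_sub_div _ _ (by positivity) (by positivity), div_le_div_iff₀ (by positivity) (by positivity)]
      have : (0:ℝ) ≤ n := Nat.cast_nonneg n
      nlinarith
    linarith
  have hl : Filter.Tendsto (fun k : ℕ => tt (k+1) - 1/((k:ℝ)+1)) Filter.atTop (nhds 0) := by
    have := ((Filter.tendsto_add_atTop_iff_nat 1).mpr tt_tendsto).sub (tendsto_one_div_add_atTop_nhds_zero_nat (𝕜 := ℝ))
    simpa using this
  have := ha.le_of_tendsto hl k
  linarith

lemma tt_upper (k : ℕ) : tt (k+2) ≤ 1/((k:ℝ)+1) := by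
  have ha : Monotone (fun k : ℕ => tt (k+2) - 1/((k:ℝ)+1)) := by
    apply monotone_nat_of_le_succ
    intro n
    rw [show n + 1 + 2 = (n + 2) + 1 from rfl, tt_succ (n+2)]
    push_cast
    have : 1/((n:ℝ)+2)^2 ≤ 1/((n:ℝ)+1) - 1/((n:ℝ)+1+1) := by
      rw [div_sub_div _ _ (by positivity) (by positivity), div_le_div_iff₀ (by positivity) (by positivity)]
      have : (0:ℝ) ≤ n := Nat.cast_nonneg n
      nlinarith
    linarith
  have hl : Filter.Tendsto (fun k : ℕ => tt (k+2) - 1/((k:ℝ)+1)) Filter.atTop (nhds 0) := by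
    have := ((Filter.tendsto_add_atTop_iff_nat 2).mpr tt_tendsto).sub (tendsto_one_div_add_atTop_nhds_zero_nat (𝕜 := ℝ))
    simpa using this
  have := ha.ge_of_tendsto hl k
  linarith

lemma tt_asymp : Filter.Tendsto (fun k : ℕ => (k:ℝ) * tt k) Filter.atTop (nhds 1) := by
  rw [← Filter.tendsto_add_atTop_iff_nat 2]
  have hu : Filter.Tendsto (fun k : ℕ => 1 + 1/((k:ℝ)+1)) Filter.atTop (nhds 1) := by
    have := (tendsto_one_div_add_atTop_nhds_zero_nat (𝕜 := ℝ)).const_add 1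
    simpa using this
  refine tendsto_of_tendsto_of_tendsto_of_le_of_le tendsto_const_nhds hu ?_ ?_
  · intro k
    have := tt_lower (k+1)
    push_cast at this ⊢
    have h2 := mul_le_mul_of_nonneg_left this (by positivity : (0:ℝ) ≤ (k:ℝ)+2)
    have e : ((k:ℝ)+2) * (1/((k:ℝ)+1+1)) = 1 := by
      rw [show (k:ℝ)+1+1 = k+2 by ring]; field_simp
    rw [e] at h2; exact h2
  · intro k
    have := tt_upper k
    push_cast
    have h2 := mul_le_mul_of_nonneg_left this (by positivity : (0:ℝ) ≤ (k:ℝ)+2)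
    have e : ((k:ℝ)+2) * (1/((k:ℝ)+1)) = 1 + 1/((k:ℝ)+1) := by
      field_simp; ring
    rw [e] at h2; exact h2

lemma qq_asymp : Filter.Tendsto (fun k : ℕ => qq k * (k:ℝ)^(3/2:ℝ)) Filter.atTop (nhds (2 * √Real.pi)) := by
  have hG : Real.Gamma (1/2) ≠ 0 := (Real.Gamma_pos_of_pos (by norm_num)).ne'
  have h := ((poch_asymp (1/2) hG).inv₀ (by simpa using hG)).const_mul 2
  rw [show 2 * (1 / Real.Gamma (1/2))⁻¹ = 2 * √Real.pi by rw [Real.Gamma_one_half_eq]; simp] at h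
  refine h.congr' ?_
  filter_upwards [Filter.eventually_gt_atTop 0] with k hk
  have hk' : (0:ℝ) < k := by exact_mod_cast hk
  have hp := (poch_pos (1/2) (by norm_num) k).ne'
  have e : (k:ℝ)^(3/2:ℝ) * (k:ℝ)^(1-1/2:ℝ) = (k:ℝ)^2 := by
    rw [← Real.rpow_add hk', ← Real.rpow_natCast]; norm_num
  have h0 : (k:ℝ)^(1-1/2:ℝ) ≠ 0 := (Real.rpow_pos_of_pos hk' _).ne'
  simp only [one_div] at *
  rw [qq, ← e]
  simp only [one_div]
  have h1 : (k:ℝ)^(3/2:ℝ) ≠ 0 := (Real.rpow_pos_of_pos hk' _).ne'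
  generalize (k:ℝ)^(3/2:ℝ) = X at *
  generalize (k:ℝ)^(1-2⁻¹:ℝ) = Z at *
  generalize poch 2⁻¹ k = P at *
  field_simp

lemma gamma_m32 : Real.Gamma (-(3/2)) = 4/3 * √Real.pi := by
  have h1 := Real.Gamma_add_one (s := -(3/2)) (by norm_num)
  have h2 := Real.Gamma_add_one (s := -(1/2)) (by norm_num)
  rw [show (-(1/2:ℝ) + 1) = 1/2 by norm_num, Real.Gamma_one_half_eq] at h2
  rw [show (-(3/2:ℝ) + 1) = -(1/2) by norm_num] at h1
  rw [h1] at h2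
  linarith

lemma eb_asymp : Filter.Tendsto (fun k : ℕ => eb k * (k:ℝ)^(5/2:ℝ)) Filter.atTop (nhds (3 / (4 * √Real.pi))) := by
  have hp : 0 < √Real.pi := Real.sqrt_pos.mpr Real.pi_pos
  have h := poch_asymp (-(3/2)) (by rw [gamma_m32]; positivity)
  rw [gamma_m32, show (1 - -(3/2):ℝ) = 5/2 by norm_num] at h
  have e : 1/(4/3*√Real.pi) = 3/(4*√Real.pi) := by field_simp
  rw [e] at h
  exact h

lemma eb_pos (k : ℕ) (hk : 2 ≤ k) : 0 < eb k := by
  unfold eb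
  apply div_pos _ (by positivity)
  induction k, hk using Nat.le_induction with
  | base => norm_num [poch, prod_range_succ]
  | succ k hk ih =>
    rw [poch_succ]
    have : (2:ℝ) ≤ k := by exact_mod_cast hk
    exact mul_pos ih (by linarith)

lemma aa_asymp : Filter.Tendsto (fun k : ℕ => aa k * (k:ℝ)^(5/2:ℝ)) Filter.atTop (nhds (24 * √Real.pi)) := by
  have h := (qq_asymp.mul tt_asymp).const_mul 12
  rw [show 12 * (2 * √Real.pi * 1) = 24 * √Real.pi by ring] at h
  refine h.congr' ?_
  filter_upwards [Filter.eventually_gt_atTop 0] with k hk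
  have hk' : (0:ℝ) < k := by exact_mod_cast hk
  rw [show (5/2:ℝ) = 3/2 + 1 by norm_num, Real.rpow_add_one hk'.ne', aa]; ring

lemma ratio_asymp : Filter.Tendsto (fun k : ℕ => aa k / eb k) Filter.atTop (nhds (32 * Real.pi)) := by
  have hp : 0 < √Real.pi := Real.sqrt_pos.mpr Real.pi_pos
  have h := aa_asymp.div eb_asymp (by positivity)
  rw [show 24 * √Real.pi / (3 / (4 * √Real.pi)) = 32 * (√Real.pi * √Real.pi) by field_simp; ring, Real.mul_self_sqrt Real.pi_pos.le] at h
  refine h.congr' ?_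
  filter_upwards [Filter.eventually_gt_atTop 0] with k hk
  have hk' : (0:ℝ) < k := by exact_mod_cast hk
  have h1 : (k:ℝ)^(5/2:ℝ) ≠ 0 := (Real.rpow_pos_of_pos hk' _).ne'
  simp only [Pi.div_apply]
  rw [mul_div_mul_right _ _ h1]

lemma summable_of_asymp (d : ℕ → ℝ) (L : ℝ) (h : Filter.Tendsto (fun k : ℕ => d k * (k:ℝ)^(5/2:ℝ)) Filter.atTop (nhds L)) :
    Summable d := by
  have h2 : Summable (fun k : ℕ => (k:ℝ)^(-(5/2):ℝ)) := Real.summable_nat_rpow.mpr (by norm_num)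
  refine summable_of_isBigO_nat h2 ?_
  have h3 := h.isBigO_one ℝ
  have h4 := h3.mul (Asymptotics.isBigO_refl (fun k : ℕ => (k:ℝ)^(-(5/2):ℝ)) Filter.atTop)
  refine (h4.congr' ?_ (by filter_upwards with k; rw [one_mul]))
  filter_upwards [Filter.eventually_gt_atTop 0] with k hk
  have hk' : (0:ℝ) < k := by exact_mod_cast hk
  rw [mul_assoc, ← Real.rpow_add hk']; norm_num

lemma mom_hasSum (α : ℝ) (hα : -1/2 ≤ α) (n : ℕ) (d : ℕ → ℝ) (hd : Summable d) (g : ℝ → ℝ)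
    (hg : ∀ x, 0 < x → x ≤ Real.pi → HasSum (fun k => d k * Real.cos (x/2) ^ (2*k)) (g x)) :
    HasSum (fun k => d k * ∫ x in (0:ℝ)..Real.pi, (Real.cos (x/2) ^ (2*k)) *
      jacobiP α (-1/2) n (Real.cos x) *
      Real.sin (x / 2) ^ (2 * α + 1) * Real.cos (x / 2) ^ (2 * (-1/2:ℝ) + 1))
     (∫ x in (0:ℝ)..Real.pi, g x *
      jacobiP α (-1/2) n (Real.cos x) *
      Real.sin (x / 2) ^ (2 * α + 1) * Real.cos (x / 2) ^ (2 * (-1/2:ℝ) + 1)) := by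
  simp_rw [← intervalIntegral.integral_const_mul]
  have hP : Continuous (fun x : ℝ => jacobiP α (-1/2) n (Real.cos x)) := by
    unfold jacobiP; fun_prop
  have hS : Continuous (fun x : ℝ => Real.sin (x / 2) ^ (2 * α + 1)) :=
    Continuous.rpow_const (by fun_prop) (fun x => Or.inr (by linarith))
  have hC : Continuous (fun x : ℝ => Real.cos (x / 2) ^ (2 * (-1/2:ℝ) + 1)) :=
    Continuous.rpow_const (by fun_prop) (fun x => Or.inr (by norm_num))
  set φ : ℝ → ℝ := fun x => jacobiP α (-1/2) n (Real.cos x) *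
      Real.sin (x / 2) ^ (2 * α + 1) * Real.cos (x / 2) ^ (2 * (-1/2:ℝ) + 1) with hφ
  have hφc : Continuous φ := by fun_prop
  have hd' := hd.abs
  apply intervalIntegral.hasSum_integral_of_dominated_convergence (fun k x => |d k| * |φ x|)
  · intro k
    apply Continuous.aestronglyMeasurable
    fun_prop
  · intro k
    filter_upwards with x _
    have : d k * (Real.cos (x/2) ^ (2*k) * jacobiP α (-1/2) n (Real.cos x) *
      Real.sin (x / 2) ^ (2 * α + 1) * Real.cos (x / 2) ^ (2 * (-1/2:ℝ) + 1)) = d k * φ x * Real.cos (x/2) ^ (2*k) := by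
      simp only [hφ]; ring
    rw [this, Real.norm_eq_abs, abs_mul, abs_mul]
    apply mul_le_of_le_one_right (by positivity)
    rw [abs_pow]
    exact pow_le_one₀ (abs_nonneg _) (Real.abs_cos_le_one _)
  · filter_upwards with x _
    exact hd'.mul_right _
  · simp_rw [tsum_mul_right]
    apply Continuous.intervalIntegrable
    fun_prop
  · filter_upwards with x hx
    rw [Set.uIoc_of_le Real.pi_pos.le] at hx
    have := (hg x hx.1 hx.2).mul_right (φ x)
    have e1 : (fun k => d k * (Real.cos (x/2) ^ (2*k) * jacobiP α (-1/2) n (Real.cos x) *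
      Real.sin (x / 2) ^ (2 * α + 1) * Real.cos (x / 2) ^ (2 * (-1/2:ℝ) + 1))) =
      fun k => d k * Real.cos (x/2) ^ (2*k) * φ x := by
      funext k; simp only [hφ]; ring
    have e2 : g x * jacobiP α (-1/2) n (Real.cos x) *
      Real.sin (x / 2) ^ (2 * α + 1) * Real.cos (x / 2) ^ (2 * (-1/2:ℝ) + 1) = g x * φ x := by
      simp only [hφ]; ring
    rw [e1, e2]
    exact this

lemma compare (d e : ℕ → ℝ) (M : ℕ → ℕ → ℝ) (D E : ℕ → ℝ) (ρ : ℝ)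
    (hM : ∀ n, 1 ≤ n → ∀ k, 0 ≤ M n k) (hM0 : ∀ n, 1 ≤ n → ∀ k, k < n → M n k = 0)
    (hD : ∀ n, 1 ≤ n → HasSum (fun k => d k * M n k) (D n))
    (hE : ∀ n, 1 ≤ n → HasSum (fun k => e k * M n k) (E n))
    (he : ∀ k, 2 ≤ k → 0 < e k)
    (hr : Filter.Tendsto (fun k => d k / e k) Filter.atTop (nhds ρ)) :
    (fun n => D n - ρ * E n) =o[Filter.atTop] E := by
  rw [Asymptotics.isLittleO_iff]
  intro ε hε
  have h1 := (Metric.tendsto_atTop.mp hr) ε hε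
  obtain ⟨N, hN⟩ := h1
  filter_upwards [Filter.eventually_ge_atTop (N + 2)] with n hn
  have hn1 : 1 ≤ n := by omega
  have hDE := (hD n hn1).sub ((hE n hn1).mul_left ρ)
  have hεE := (hE n hn1).mul_left ε
  have hb : ∀ k, |d k * M n k - ρ * (e k * M n k)| ≤ ε * (e k * M n k) := by
    intro k
    rcases lt_or_ge k n with h | h
    · rw [hM0 n hn1 k h]; simp
    · have hek := he k (by omega)
      have := (hN k (by omega)).le
      rw [Real.dist_eq] at this
      have e1 : d k * M n k - ρ * (e k * M n k) = (d k / e k - ρ) * (e k * M n k) := by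
        field_simp
      rw [e1, abs_mul, abs_of_nonneg (mul_nonneg hek.le (hM n hn1 k))]
      exact mul_le_mul_of_nonneg_right this (mul_nonneg hek.le (hM n hn1 k))
  have u := hasSum_le (fun k => (le_abs_self _).trans (hb k)) hDE hεE
  have l := hasSum_le (fun k => neg_le.mp ((neg_le_abs _).trans (hb k))) hεE.neg hDE
  have : |D n - ρ * E n| ≤ ε * E n := abs_le.mpr ⟨l, u⟩
  rw [Real.norm_eq_abs, Real.norm_eq_abs]
  exact this.trans (mul_le_mul_of_nonneg_left (le_abs_self _) hε.le)


lemma p1_hasSum (x : ℝ) (h0 : 0 < x) (h1 : x ≤ Real.pi) :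
    HasSum (fun k => aa k * Real.cos (x/2) ^ (2*k))
      (2 * Real.pi^2 * (Real.pi - x)^2 - (Real.pi - x)^4) := by
  have h := aa_hasSum (Real.pi - x) (by linarith) (by linarith)
  have e : vv (Real.pi - x) = Real.cos (x/2) ^ 2 := by
    rw [vv_eq, show (Real.pi - x)/2 = Real.pi/2 - x/2 by ring, Real.sin_pi_div_two_sub]
  rw [e] at h
  simp_rw [pow_mul]
  exact h

lemma s3_hasSum (x : ℝ) (h0 : 0 < x) (h1 : x ≤ Real.pi) :
    HasSum (fun k => eb k * Real.cos (x/2) ^ (2*k)) (Real.sin (x/2) ^ (3:ℝ)) := by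
  have hs : 0 < Real.sin (x/2) := Real.sin_pos_of_pos_of_lt_pi (by linarith) (by linarith)
  have hsc := Real.sin_sq_add_cos_sq (x/2)
  have h := eb_hasSum (Real.cos (x/2) ^ 2) (by positivity) (by nlinarith [sq_pos_of_pos hs])
  have e : (1 - Real.cos (x/2)^2)^(3/2:ℝ) = Real.sin (x/2) ^ (3:ℝ) := by
    rw [show 1 - Real.cos (x/2)^2 = Real.sin (x/2)^(2:ℝ) by rw [Real.rpow_two]; linarith,
      ← Real.rpow_mul hs.le]
    norm_num
  rw [e] at h
  simp_rw [pow_mul]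
  exact h

/-- The prefactor. -/
noncomputable def kap (α : ℝ) (n : ℕ) : ℝ :=
  (2 * n + α + (-1/2) + 1) * Real.Gamma (n + α + (-1/2) + 1) /
      (Real.Gamma (n + (-1/2) + 1) * Real.Gamma (α + 1))

lemma kapE (α : ℝ) (hα : -1/2 ≤ α) (n : ℕ) (hn : 1 ≤ n) :
    kap α n * (√Real.pi * Real.Gamma (α+5/2) * poch (1/2) n * poch (-(3/2)) n /
      (n.factorial * Real.Gamma (α+3+n))) =
    (2 * n + (α + 1/2)) / (n + (α + 1/2)) * (Real.Gamma (α+3/2) * poch (α+3/2) n) *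
      Real.Gamma (α+5/2) * eb n / (Real.Gamma (α+1) * (Real.Gamma (α+3) * poch (α+3) n)) := by
  have hn' : (1:ℝ) ≤ n := by exact_mod_cast hn
  have hs : (0:ℝ) < n + (α+1/2) := by linarith
  have g1 := gamma_poch (1/2) (by norm_num) n
  have g2 := gamma_poch (α+3/2) (by linarith) n
  have g3 := gamma_poch (α+3) (by linarith) n
  have g4 := Real.Gamma_add_one hs.ne'
  rw [show (n:ℝ) + (α+1/2) + 1 = α + 3/2 + n by ring, g2] at g4
  have p1 := (poch_pos (1/2) (by norm_num) n).ne'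
  have p3 := (poch_pos (α+3) (by linarith) n).ne'
  have q1 := (Real.Gamma_pos_of_pos (by linarith : 0 < α + 1)).ne'
  have q3 := (Real.Gamma_pos_of_pos (by linarith : 0 < α + 3)).ne'
  have hpi : √Real.pi ≠ 0 := (Real.sqrt_pos.mpr Real.pi_pos).ne'
  rw [Real.Gamma_one_half_eq] at g1
  unfold kap eb
  rw [show (n:ℝ) + (-1/2) + 1 = 1/2 + n by ring, show (n:ℝ) + α + (-1/2) + 1 = n + (α + 1/2) by ring,
    g1, g3, g4, show (2:ℝ)*n + α + (-1/2) + 1 = 2*n + (α+1/2) by ring]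
  have hf : (n.factorial:ℝ) ≠ 0 := by positivity
  have hs' := hs.ne'
  generalize (n.factorial:ℝ) = F at *
  generalize poch (1/2) n = P1 at *
  generalize poch (α+3) n = P3 at *
  generalize poch (-(3/2)) n = P4 at *
  generalize Real.Gamma (α+1) = Q1 at *
  generalize Real.Gamma (α+3) = Q3 at *
  generalize Real.Gamma (α+5/2) = Q5 at *
  generalize Real.Gamma (n+(α+1/2)) = G at *
  generalize √Real.pi = R at *
  generalize (n:ℝ)+(α+1/2) = S at *
  field_simp

lemma frac_asymp (c : ℝ) : Filter.Tendsto (fun n : ℕ => (2 * (n:ℝ) + c) / (n + c)) Filter.atTop (nhds 2) := by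
  have h := (tendsto_natCast_div_add_atTop c).const_add 1
  rw [show (1:ℝ)+1 = 2 by norm_num] at h
  refine h.congr' ?_
  filter_upwards [(tendsto_natCast_atTop_atTop (R := ℝ)).eventually_gt_atTop (-c)] with n hn
  have : (n:ℝ) + c ≠ 0 := by intro h; linarith
  field_simp
  ring

lemma kapE_asymp (α : ℝ) (hα : -1/2 ≤ α) :
    Filter.Tendsto (fun n : ℕ => (n:ℝ)^4 * (kap α n * (√Real.pi * Real.Gamma (α+5/2) * poch (1/2) n * poch (-(3/2)) n /
      (n.factorial * Real.Gamma (α+3+n))))) Filter.atTop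
      (nhds (2 * (3 / (4 * √Real.pi)) * Real.Gamma (α+5/2) / Real.Gamma (α+1))) := by
  have q1 := (Real.Gamma_pos_of_pos (by linarith : 0 < α + 1)).ne'
  have q2 := (Real.Gamma_pos_of_pos (by linarith : 0 < α + 3/2)).ne'
  have q3 := (Real.Gamma_pos_of_pos (by linarith : 0 < α + 3)).ne'
  have h1 := (poch_asymp (α+3/2) q2).div (poch_asymp (α+3) q3) (by simpa using q3)
  have h2 := (((frac_asymp (α+1/2)).mul eb_asymp).mul h1).mul_const
    (Real.Gamma (α+5/2) * Real.Gamma (α+3/2) / (Real.Gamma (α+1) * Real.Gamma (α+3)))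
  have e : 2 * (3 / (4 * √Real.pi)) * (1 / Real.Gamma (α+3/2) / (1 / Real.Gamma (α+3))) *
      (Real.Gamma (α+5/2) * Real.Gamma (α+3/2) / (Real.Gamma (α+1) * Real.Gamma (α+3))) =
      2 * (3 / (4 * √Real.pi)) * Real.Gamma (α+5/2) / Real.Gamma (α+1) := by
    clear h1 h2
    generalize Real.Gamma (α+3/2) = Q2 at *
    generalize Real.Gamma (α+5/2) = Q5 at *
    field_simp
  rw [e] at h2
  refine h2.congr' ?_
  filter_upwards [Filter.eventually_ge_atTop 1] with n hn
  rw [kapE α hα n hn]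
  have hn' : (0:ℝ) < n := by exact_mod_cast hn
  have p3 := (poch_pos (α+3) (by linarith) n).ne'
  have hf : (n.factorial:ℝ) ≠ 0 := by positivity
  have e4 : (n:ℝ)^4 = (n:ℝ)^(5/2:ℝ) * ((n:ℝ)^(1-(α+3/2)) / (n:ℝ)^(1-(α+3))) := by
    rw [← Real.rpow_sub hn', ← Real.rpow_add hn', ← Real.rpow_natCast]; norm_num
  have hz : (n:ℝ)^(1-(α+3)) ≠ 0 := (Real.rpow_pos_of_pos hn' _).ne'
  rw [e4]
  simp only [Pi.div_apply]
  generalize (2 * (n:ℝ) + (α + 1/2)) / (n + (α + 1/2)) = W at *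
  generalize (n:ℝ)^(1-(α+3)) = Z at *
  generalize (n:ℝ)^(1-(α+3/2)) = Y at *
  generalize (n:ℝ)^(5/2:ℝ) = X at *
  generalize (n.factorial:ℝ) = F at *
  generalize poch (α+3) n = P3 at *
  generalize poch (α+3/2) n = P2 at *
  generalize Real.Gamma (α+1) = Q1 at *
  generalize Real.Gamma (α+3) = Q3 at *
  generalize Real.Gamma (α+3/2) = Q2 at *
  generalize Real.Gamma (α+5/2) = Q5 at *
  field_simp


end Aux

/-- Example 2: `n⁴ b_n^{(α,−1/2)}(2π²(π−x)² − (π−x)⁴) → 48√π Γ(α+5/2)/Γ(α+1)`. -/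
theorem stmt14 (α : ℝ) (hα : -1/2 ≤ α) :
    Filter.Tendsto
      (fun n : ℕ => (n:ℝ)^4 *
        jacobiCoeff α (-1/2) n (fun x => 2 * Real.pi^2 * (Real.pi - x)^2 - (Real.pi - x)^4))
      Filter.atTop
      (nhds (48 * Real.sqrt Real.pi * Real.Gamma (α+5/2) / Real.Gamma (α+1))) := by
  set M : ℕ → ℕ → ℝ := fun n k => ∫ x in (0:ℝ)..Real.pi, (Real.cos (x/2) ^ (2*k)) *
      jacobiP α (-1/2) n (Real.cos x) *
      Real.sin (x / 2) ^ (2 * α + 1) * Real.cos (x / 2) ^ (2 * (-1/2:ℝ) + 1) with hMdef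
  set D : ℕ → ℝ := fun n => ∫ x in (0:ℝ)..Real.pi,
      (2 * Real.pi^2 * (Real.pi - x)^2 - (Real.pi - x)^4) *
      jacobiP α (-1/2) n (Real.cos x) *
      Real.sin (x / 2) ^ (2 * α + 1) * Real.cos (x / 2) ^ (2 * (-1/2:ℝ) + 1) with hDdef
  set E : ℕ → ℝ := fun n => ∫ x in (0:ℝ)..Real.pi, (Real.sin (x/2) ^ (3:ℝ)) *
      jacobiP α (-1/2) n (Real.cos x) *
      Real.sin (x / 2) ^ (2 * α + 1) * Real.cos (x / 2) ^ (2 * (-1/2:ℝ) + 1) with hEdef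
  have hMf : ∀ n, 1 ≤ n → ∀ k, M n k = Real.Gamma (α + n + 1) / n.factorial *
      Real.Gamma (k + 1/2) * k.descFactorial n / Real.Gamma (α + 3/2 + k + n) :=
    fun n hn k => mom_pow α hα k n hn
  have hM : ∀ n, 1 ≤ n → ∀ k, 0 ≤ M n k := by
    intro n hn k
    rw [hMf n hn k]
    have hn0 : (0:ℝ) ≤ n := Nat.cast_nonneg n
    have hk0 : (0:ℝ) ≤ k := Nat.cast_nonneg k
    have a1 := Real.Gamma_pos_of_pos (by linarith : 0 < α + n + 1)
    have a2 := Real.Gamma_pos_of_pos (by linarith : 0 < (k:ℝ) + 1/2)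
    have a3 := Real.Gamma_pos_of_pos (by linarith : 0 < α + 3/2 + k + n)
    positivity
  have hM0 : ∀ n, 1 ≤ n → ∀ k, k < n → M n k = 0 := by
    intro n hn k hk
    rw [hMf n hn k, Nat.descFactorial_of_lt hk]
    simp
  have hlo : (fun n => D n - 32 * Real.pi * E n) =o[Filter.atTop] E :=
    compare aa eb M D E (32 * Real.pi) hM hM0
      (fun n _ => mom_hasSum α hα n aa (summable_of_asymp _ _ aa_asymp) _ p1_hasSum)
      (fun n _ => mom_hasSum α hα n eb (summable_of_asymp _ _ eb_asymp) _ s3_hasSum)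
      eb_pos ratio_asymp
  have hE : Filter.Tendsto (fun n : ℕ => (n:ℝ)^4 * kap α n * E n) Filter.atTop
      (nhds (2 * (3 / (4 * √Real.pi)) * Real.Gamma (α+5/2) / Real.Gamma (α+1))) := by
    refine (kapE_asymp α hα).congr' ?_
    filter_upwards [Filter.eventually_ge_atTop 1] with n hn
    have : E n = √Real.pi * Real.Gamma (α+5/2) * poch (1/2) n * poch (-(3/2)) n /
      (n.factorial * Real.Gamma (α+3+n)) := mom_sin α hα n hn
    rw [this]
    exact (mul_assoc _ _ _).symm
  have h1 := (Asymptotics.isBigO_refl (fun n : ℕ => (n:ℝ)^4 * kap α n) Filter.atTop).mul_isLittleO hlo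
  have h2 := (h1.trans_isBigO (hE.isBigO_one ℝ))
  rw [Asymptotics.isLittleO_one_iff] at h2
  have h3 := (hE.const_mul (32 * Real.pi)).add h2
  have hp : √Real.pi ≠ 0 := (Real.sqrt_pos.mpr Real.pi_pos).ne'
  have q1 := (Real.Gamma_pos_of_pos (by linarith : 0 < α + 1)).ne'
  have e : 32 * Real.pi * (2 * (3 / (4 * √Real.pi)) * Real.Gamma (α+5/2) / Real.Gamma (α+1)) + 0 =
      48 * √Real.pi * Real.Gamma (α+5/2) / Real.Gamma (α+1) := by
    have : Real.pi = √Real.pi * √Real.pi := (Real.mul_self_sqrt Real.pi_pos.le).symm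
    generalize √Real.pi = R at *
    rw [this]
    field_simp
    ring
  rw [e] at h3
  refine h3.congr ?_
  intro n
  have : jacobiCoeff α (-1/2) n (fun x => 2 * Real.pi^2 * (Real.pi - x)^2 - (Real.pi - x)^4) =
    kap α n * D n := rfl
  rw [this]
  ring
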